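/- arXiv:2402.02560 — 2 statements merged into one kernel-verified Lean document; each statement's English description precedes it below -/
import Mathlib

section
/- Let p ≥ 1 and let F = F_0 + F_p be the polynomial vector field on ℝⁿ with F_0(x) = (x_n, x_{n−1}, …, x_1) and F_p(x) = (1/(p+1)) · (x_1^{p+1}, …, x_n^{p+1}); write F = (f_1, …, f_n) in coordinates. For 1 ≤ i ≤ ⌊(n+1)/2⌋ let v^{(i)} be the vector field whose i-th component is f_i, whose (n−i+1)-st component is f_{n−i+1}, and whose remaining components are 0. Then the vector space of polynomial vector fields G with [F, G] = 0 has the set { v^{(i)} : 1 ≤ i ≤ ⌊(n+1)/2⌋ } as a basis. -/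
open MvPolynomial

/-- The Lie bracket `[F,G](x) = (dG/dx)(x) F(x) − (dF/dx)(x) G(x)` of polynomial vector
fields on `ℝⁿ`. -/
noncomputable def bracket {n : ℕ} (F G : Fin n → MvPolynomial (Fin n) ℝ) :
    Fin n → MvPolynomial (Fin n) ℝ :=
  fun i => (∑ j, pderiv j (G i) * F j) - ∑ j, pderiv j (F i) * G j

/-- The vector field `F = F_0 + F_p` with `F_0(x) = (x_n, x_{n−1}, …, x_1)` and
`F_p(x) = (1/(p+1)) (x_1^{p+1}, …, x_n^{p+1})` (0-based indexing: the `k`-th component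
is `x_{n-1-k} + (1/(p+1)) x_k^{p+1}`). -/
noncomputable def FHH (n p : ℕ) : Fin n → MvPolynomial (Fin n) ℝ :=
  fun k => X k.rev + C (((p : ℝ) + 1)⁻¹) * X k ^ (p + 1)

/-- For `1 ≤ i ≤ ⌊(n+1)/2⌋`, the vector field `v⁽ⁱ⁾` whose `i`-th component is `f_i`,
whose `(n−i+1)`-st component is `f_{n−i+1}`, and whose other components vanish
(0-based: components at positions `i` and `n-1-i` of `F`). -/
noncomputable def vHH (n p : ℕ) : Fin ((n + 1) / 2) → Fin n → MvPolynomial (Fin n) ℝ :=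
  fun i k => if k.val = i.val ∨ k.val = n - 1 - i.val then FHH n p k else 0


/-- The derivation along `V`. -/
noncomputable def Dv {n : ℕ} (V : Fin n → MvPolynomial (Fin n) ℝ) :
    MvPolynomial (Fin n) ℝ →ₗ[ℝ] MvPolynomial (Fin n) ℝ where
  toFun g := ∑ j, pderiv j g * V j
  map_add' a b := by simp [add_mul, Finset.sum_add_distrib]
  map_smul' r a := by simp [Finset.smul_sum]

noncomputable def Vp (n p : ℕ) : Fin n → MvPolynomial (Fin n) ℝ :=
  fun k => C (((p : ℝ) + 1)⁻¹) * X k ^ (p + 1)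

noncomputable def V0 (n : ℕ) : Fin n → MvPolynomial (Fin n) ℝ :=
  fun k => X k.rev

lemma Dv_apply {n : ℕ} (V : Fin n → MvPolynomial (Fin n) ℝ) (g) :
    Dv V g = ∑ j, pderiv j g * V j := rfl

lemma pderiv_FHH (n p : ℕ) (i j : Fin n) :
    pderiv j (FHH n p i) = (if j = i.rev then 1 else 0) + (if j = i then X i ^ p else 0) := by
  have h : ((p : ℝ) + 1) ≠ 0 := by positivity
  unfold FHH
  rw [map_add, pderiv_C_mul, pderiv_pow, pderiv_X, pderiv_X]
  simp only [Pi.single_apply, eq_comm (b := j)]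
  congr 1
  split_ifs with h1
  · rw [mul_one, Nat.add_sub_cancel, ← mul_assoc]
    have : ((p + 1 : ℕ) : MvPolynomial (Fin n) ℝ) = C ((p : ℝ) + 1) := by simp
    rw [this, ← C_mul, inv_mul_cancel₀ h, C_1, one_mul]
  · simp

lemma bracket_FHH (n p : ℕ) (G : Fin n → MvPolynomial (Fin n) ℝ) (i : Fin n) :
    bracket (FHH n p) G i =
      Dv (V0 n) (G i) + Dv (Vp n p) (G i) - (G i.rev + X i ^ p * G i) := by
  simp only [bracket, pderiv_FHH, Dv_apply, add_mul, Finset.sum_add_distrib, ite_mul, one_mul,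
    zero_mul, Finset.sum_ite_eq', Finset.mem_univ, if_true, ← Finset.sum_add_distrib, ← mul_add]
  simp [Finset.sum_add_distrib, FHH, V0, Vp]

lemma hc_shift {n : ℕ} (L : MvPolynomial (Fin n) ℝ →ₗ[ℝ] MvPolynomial (Fin n) ℝ) (q : ℕ)
    (hL : ∀ d g, g.IsHomogeneous d → (L g).IsHomogeneous (d + q)) (k : ℕ)
    (g : MvPolynomial (Fin n) ℝ) :
    homogeneousComponent (k + q) (L g) = L (homogeneousComponent k g) := by
  conv_lhs => rw [← sum_homogeneousComponent g]
  rw [map_sum, map_sum]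
  have : ∀ d ∈ Finset.range (g.totalDegree + 1),
      homogeneousComponent (k + q) (L (homogeneousComponent d g)) =
        if k = d then L (homogeneousComponent k g) else 0 := by
    intro d _
    rw [homogeneousComponent_of_mem (hL d _ (homogeneousComponent_isHomogeneous d g))]
    by_cases h : k = d
    · subst h; simp
    · simp [h]
  rw [Finset.sum_congr rfl this, Finset.sum_ite_eq]
  split_ifs with h
  · rfl
  · rw [homogeneousComponent_eq_zero, map_zero]
    simpa using h

lemma Dv_hom {n : ℕ} (V : Fin n → MvPolynomial (Fin n) ℝ) (q : ℕ)
    (hV : ∀ j, (V j).IsHomogeneous (q + 1)) (d : ℕ) (g : MvPolynomial (Fin n) ℝ)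
    (hg : g.IsHomogeneous d) : (Dv V g).IsHomogeneous (d + q) := by
  rw [Dv_apply]
  apply IsHomogeneous.sum
  intro j _
  rcases d with _ | d
  · rw [← totalDegree_zero_iff_isHomogeneous, totalDegree_eq_zero_iff_eq_C] at hg
    rw [hg, pderiv_C, zero_mul]; apply isHomogeneous_zero
  · have := (hg.pderiv (i := j)).mul (hV j)
    convert this using 1
    omega

/-- The graded equation. -/
lemma graded (n p : ℕ) (G : Fin n → MvPolynomial (Fin n) ℝ) (h : bracket (FHH n p) G = 0)
    (k : ℕ) (i : Fin n) :
    Dv (Vp n p) (homogeneousComponent k (G i)) - X i ^ p * homogeneousComponent k (G i)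
      = homogeneousComponent (k + p) (G i.rev)
        - Dv (V0 n) (homogeneousComponent (k + p) (G i)) := by
  have h1 := congrFun h i
  rw [bracket_FHH] at h1
  have h2 := congrArg (homogeneousComponent (k + p)) h1
  simp only [map_sub, map_add, Pi.zero_apply, map_zero] at h2
  rw [hc_shift (Dv (Vp n p)) p (Dv_hom _ _ fun j => isHomogeneous_C_mul_X_pow _ _ _)] at h2
  have h3 := hc_shift (Dv (V0 n)) 0 (Dv_hom _ _ fun j => isHomogeneous_X _ _) (k + p) (G i)
  have h4 := hc_shift (LinearMap.mulLeft ℝ (X i ^ p : MvPolynomial (Fin n) ℝ)) p (by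
    intro d g hg
    rw [add_comm]
    exact (isHomogeneous_X_pow _ _).mul hg) k (G i)
  simp only [LinearMap.mulLeft_apply, add_zero] at h3 h4
  rw [h3, h4] at h2
  linear_combination h2

lemma kernel_deg {n p : ℕ} (hp : 1 ≤ p) (i : Fin n) (g : MvPolynomial (Fin n) ℝ)
    (h : Dv (Vp n p) g = X i ^ p * g) (j : Fin n) (hj : j ≠ i) : degreeOf j g = 0 := by
  by_contra hd
  have hg : g.support.Nonempty := by
    rw [Finset.nonempty_iff_ne_empty]
    intro h0
    rw [support_eq_empty] at h0
    simp [h0] at hd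
  obtain ⟨α, hα, hαd⟩ := Finset.exists_mem_eq_sup g.support hg (fun m => m j)
  rw [← degreeOf_eq_sup] at hαd
  have hz : ∀ β : Fin n →₀ ℕ, degreeOf j g < β j → coeff β g = 0 := by
    intro β hβ
    by_contra hne
    have := monomial_le_degreeOf j (mem_support_iff.2 hne)
    omega
  have h1 := congrArg (coeff (α + Finsupp.single j p)) h
  rw [Dv_apply, coeff_sum, Finset.sum_eq_single j] at h1
  · rw [mul_comm (X i ^ p), X_pow_eq_monomial, coeff_mul_monomial'] at h1
    rw [Vp, C_mul_X_pow_eq_monomial, coeff_mul_monomial'] at h1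
    have e1 : (if Finsupp.single i p ≤ α + Finsupp.single j p then
        coeff (α + Finsupp.single j p - Finsupp.single i p) g * 1 else 0) = 0 := by
      split_ifs
      · rw [hz, zero_mul]
        simp [Finsupp.single_apply, hj.symm]
        omega
      · rfl
    have e2 : Finsupp.single j (p+1) ≤ α + Finsupp.single j p := by
      intro k
      simp only [Finsupp.add_apply, Finsupp.single_apply]
      split_ifs with hk
      · subst hk; omega
      · omega
    rw [e1, if_pos e2, coeff_pderiv] at h1
    have e3 : α + Finsupp.single j p - Finsupp.single j (p + 1) + Finsupp.single j 1 = α := by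
      ext k
      simp only [Finsupp.add_apply, Finsupp.tsub_apply, Finsupp.single_apply]
      split_ifs with hk
      · subst hk; omega
      · omega
    rw [e3] at h1
    have := mem_support_iff.1 hα
    have : (((α + Finsupp.single j p - Finsupp.single j (p + 1)) j : ℕ) : ℝ) + 1 ≠ 0 := by
      positivity
    have : (((p : ℝ) + 1)⁻¹) ≠ 0 := by positivity
    simp_all
  · intro k _ hk
    rw [Vp, C_mul_X_pow_eq_monomial, coeff_mul_monomial']
    split_ifs
    · rw [coeff_pderiv, hz, zero_mul, zero_mul]
      simp [Finsupp.single_apply, hk]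
      omega
    · rfl
  · simp

lemma Dv_Vp_monomial {n p : ℕ} (i : Fin n) (d : ℕ) (c : ℝ) :
    Dv (Vp n p) (C c * X i ^ d) = C (c * d / (p + 1)) * X i ^ (d + p) := by
  rw [Dv_apply, Finset.sum_eq_single i]
  · rcases d with _ | d
    · simp
    · rw [pderiv_C_mul, pderiv_pow, pderiv_X_self, Vp]
      have : ((d + 1 : ℕ) : MvPolynomial (Fin n) ℝ) = C ((d + 1 : ℕ) : ℝ) := by simp
      rw [this, div_eq_mul_inv, C_mul, C_mul]
      simp only [Nat.add_sub_cancel]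
      ring
  · intro j _ hj
    rw [pderiv_C_mul, pderiv_pow, pderiv_X_of_ne hj.symm]
    simp
  · simp

lemma Dv_V0_monomial {n : ℕ} (i : Fin n) (d : ℕ) (c : ℝ) :
    Dv (V0 n) (C c * X i ^ (d + 1)) = C (c * (d + 1)) * X i ^ d * X i.rev := by
  rw [Dv_apply, Finset.sum_eq_single i]
  · rw [pderiv_C_mul, pderiv_pow, pderiv_X_self, V0]
    have : ((d + 1 : ℕ) : MvPolynomial (Fin n) ℝ) = C ((d : ℝ) + 1) := by simp
    rw [this, C_mul]
    simp only [Nat.add_sub_cancel]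
    ring
  · intro j _ hj
    rw [pderiv_C_mul, pderiv_pow, pderiv_X_of_ne hj.symm]
    simp
  · simp

lemma kernel {n p : ℕ} (hp : 1 ≤ p) (i : Fin n) (g : MvPolynomial (Fin n) ℝ) (d : ℕ)
    (hg : g.IsHomogeneous d)
    (h : Dv (Vp n p) g = X i ^ p * g) :
    ∃ c : ℝ, g = C c * X i ^ d ∧ (d ≠ p + 1 → c = 0) := by
  have h0 : g = C (coeff (Finsupp.single i d) g) * X i ^ d := by
    ext β
    rw [C_mul_X_pow_eq_monomial, coeff_monomial]
    split_ifs with hβ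
    · rw [hβ]
    · by_contra hne
      apply hβ
      have hs : ∀ j, j ≠ i → β j = 0 := fun j hj => by
        have := monomial_le_degreeOf j (mem_support_iff.2 hne)
        have := kernel_deg hp i g h j hj
        omega
      have hb : β = Finsupp.single i (β i) := by
        ext j
        rw [Finsupp.single_apply]
        split_ifs with hj
        · rw [hj]
        · exact hs j (Ne.symm hj)
      have hdeg : β.degree = d := by
        by_contra hc
        exact hne (hg.coeff_eq_zero hc)
      rw [hb, Finsupp.degree_single] at hdeg
      rw [hb, hdeg]
  refine ⟨_, h0, ?_⟩
  generalize coeff (Finsupp.single i d) g = c at h0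
  intro hd
  rw [h0, Dv_Vp_monomial] at h
  have := congrArg (eval (fun _ => (1:ℝ))) h
  simp at this
  by_contra hc
  have hp' : ((p : ℝ) + 1) ≠ 0 := by positivity
  field_simp at this
  apply hd
  exact_mod_cast this

lemma linear_form {n : ℕ} (g : MvPolynomial (Fin n) ℝ) (hg : g.IsHomogeneous 1) :
    ∃ a : Fin n → ℝ, g = ∑ j, C (a j) * X j := by
  have : g ∈ homogeneousSubmodule (Fin n) ℝ 1 := hg
  rw [homogeneousSubmodule_one_eq_span_X, Submodule.mem_span_range_iff_exists_fun] at this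
  obtain ⟨a, ha⟩ := this
  exact ⟨a, by rw [← ha]; simp [smul_eq_C_mul]⟩

lemma deg_one {n p : ℕ} (hp : 1 ≤ p) (i : Fin n) (g : MvPolynomial (Fin n) ℝ)
    (hg : g.IsHomogeneous 1) (c c' : ℝ) (hc : i.rev = i → c' = c)
    (h : Dv (Vp n p) g - X i ^ p * g
      = C c' * X i.rev ^ (p + 1) - C (c * (p + 1)) * X i ^ p * X i.rev) :
    c' = c ∧ g = C (c * (p + 1)) * X i.rev := by
  obtain ⟨a, rfl⟩ := linear_form g hg
  have hD : Dv (Vp n p) (∑ j, C (a j) * X j) = ∑ j, C (a j / (p + 1)) * X j ^ (p + 1) := by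
    rw [map_sum]
    refine Finset.sum_congr rfl fun j _ => ?_
    have := Dv_Vp_monomial (p := p) j 1 (a j)
    rw [pow_one] at this
    rw [this, add_comm 1 p]; simp
  rw [hD] at h
  have hp' : ((p : ℝ) + 1) ≠ 0 := by positivity
  have hp0 : (p : ℝ) ≠ 0 := by positivity
  have hpn : p ≠ 0 := by omega
  have ev : ∀ x : Fin n → ℝ, ∑ j, a j / (p + 1) * x j ^ (p + 1) - x i ^ p * ∑ j, a j * x j
      = c' * x i.rev ^ (p + 1) - c * (p + 1) * x i ^ p * x i.rev := by
    intro x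
    have := congrArg (eval x) h
    simpa [eval_sum] using this
  have e1 : ∀ j, a j / (p + 1) - (if i = j then 1 else 0) * a j =
      c' * (if i.rev = j then 1 else 0) -
        c * (p + 1) * (if i = j then 1 else 0) * (if i.rev = j then 1 else 0) := by
    intro j
    have := ev (fun k => if k = j then 1 else 0)
    simpa [ite_pow, hpn] using this
  by_cases hi : i.rev = i
  · obtain rfl := hc hi
    refine ⟨rfl, ?_⟩
    rw [Finset.sum_eq_single i]
    · have := e1 i
      simp [hi] at this
      rw [hi]
      congr 2
      field_simp at this
      have h3 : (p : ℝ) * a i = p * (c' * (p + 1)) := by linear_combination -this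
      exact mul_left_cancel₀ hp0 h3
    · intro j _ hj
      have := e1 j
      simp [hi, hj.symm, hp'] at this
      simp [this]
    · simp
  · have hi' : i ≠ i.rev := fun h => hi h.symm
    have e2 := e1 i.rev
    simp [hi'] at e2
    have e4 := e1 i
    simp [hi] at e4
    have hai : a i = 0 := by
      field_simp at e4
      have h3 : (p : ℝ) * a i = 0 := by linear_combination -e4
      simpa [hp0] using h3
    have e3 := ev (fun k => if k = i then 1 else if k = i.rev then 1 else 0)
    have s1 : ∀ f : Fin n → ℝ, f i = 0 →
        ∑ j, f j * (if j = i then 1 else if j = i.rev then 1 else 0) = f i.rev := by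
      intro f hf
      rw [Finset.sum_eq_single i.rev]
      · simp
      · intro j _ hj
        by_cases hji : j = i
        · subst hji; simp [hf]
        · simp [hji, hj]
      · simp
    simp only [ite_pow, one_pow, zero_pow hpn, zero_pow (Nat.succ_ne_zero p)] at e3
    rw [s1 a hai, s1 (fun j => a j / (p + 1)) (by simp [hai])] at e3
    simp at e3
    have hcc : a i.rev = c * (p + 1) := by linear_combination e2 - e3
    refine ⟨?_, ?_⟩
    · rw [hcc] at e2
      field_simp at e2
      linear_combination -e2
    · rw [Finset.sum_eq_single i.rev]
      · rw [hcc]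
      · intro j _ hj
        by_cases hji : j = i
        · subst hji; simp [hai]
        · have := e1 j
          simp [Ne.symm hj, Ne.symm hji, hp'] at this
          simp [this]
      · simp

lemma structure_thm {n p : ℕ} (hp : 1 ≤ p) (G : Fin n → MvPolynomial (Fin n) ℝ)
    (h : bracket (FHH n p) G = 0) :
    ∃ c : Fin n → ℝ, (∀ i, c i.rev = c i) ∧ ∀ i, G i = C (c i) * FHH n p i := by
  have gr := graded n p G h
  -- step
  have step : ∀ k, k ≠ p + 1 → (∀ i, homogeneousComponent (k + p) (G i) = 0) →
      ∀ i, homogeneousComponent k (G i) = 0 := by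
    intro k hk h0 i
    have := gr k i
    rw [h0, h0, map_zero, sub_zero] at this
    obtain ⟨c, hc, hc0⟩ := kernel hp i _ k (homogeneousComponent_isHomogeneous _ _)
      (sub_eq_zero.1 this)
    rw [hc, hc0 hk]; simp
  have big : ∀ k, p + 1 < k → ∀ i, homogeneousComponent k (G i) = 0 := by
    obtain ⟨N, hN⟩ : ∃ N, ∀ i, (G i).totalDegree < N := by
      refine ⟨Finset.univ.sup (fun i => (G i).totalDegree) + 1, fun i => ?_⟩
      have := Finset.le_sup (f := fun i => (G i).totalDegree) (Finset.mem_univ i)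
      omega
    have : ∀ m k, p + 1 < k → N ≤ k + m → ∀ i, homogeneousComponent k (G i) = 0 := by
      intro m
      induction m with
      | zero =>
        intro k _ hk i
        exact homogeneousComponent_eq_zero _ _ (lt_of_lt_of_le (hN i) hk)
      | succ m ih =>
        intro k hk hk2
        exact step k (by omega) (ih (k + p) (by omega) (by omega))
    intro k hk
    exact this N k hk (by omega)
  have top : ∀ i, ∃ c : ℝ, homogeneousComponent (p + 1) (G i) = C c * X i ^ (p + 1) := by
    intro i
    have := gr (p + 1) i
    rw [big (p + 1 + p) (by omega), big (p + 1 + p) (by omega), map_zero, sub_zero] at this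
    obtain ⟨c, hc, _⟩ := kernel hp i _ _ (homogeneousComponent_isHomogeneous _ _)
      (sub_eq_zero.1 this)
    exact ⟨c, hc⟩
  choose c hc using top
  have mid : ∀ k, 1 < k → k ≠ p + 1 → ∀ i, homogeneousComponent k (G i) = 0 := by
    intro k h1 h2
    exact step k h2 (big _ (by omega))
  have one : ∀ i, c i.rev = c i ∧
      homogeneousComponent 1 (G i) = C (c i * (p + 1)) * X i.rev := by
    intro i
    have := gr 1 i
    rw [add_comm 1 p, hc, hc, Dv_V0_monomial] at this
    exact deg_one hp i _ (homogeneousComponent_isHomogeneous _ _) (c i) (c i.rev)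
      (fun h => by rw [h]) this
  have zero : ∀ i, homogeneousComponent 0 (G i) = 0 := by
    intro i
    by_cases hp1 : p = 1
    · have := gr 0 i
      rw [hp1, zero_add, (one i).2, (one i.rev).2, homogeneousComponent_zero] at this
      have e := Dv_V0_monomial i.rev 0 (c i * (p + 1))
      have e' := Dv_Vp_monomial (p := 1) i 0 (coeff 0 (G i))
      simp only [pow_zero, mul_one, zero_add, pow_one, Fin.rev_rev, (one i).1] at *
      rw [e, e'] at this
      simp at this
      simpa using this
    · apply step 0 (by omega)
      apply mid <;> omega
  refine ⟨fun i => c i * (p + 1), fun i => by simp only [(one i).1], fun i => ?_⟩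
  have hp' : ((p : ℝ) + 1) ≠ 0 := by positivity
  have hF : C (c i * (p + 1)) * FHH n p i = C (c i * (p + 1)) * X i.rev + C (c i) * X i ^ (p + 1) := by
    unfold FHH
    rw [mul_add, ← mul_assoc, ← C_mul, mul_assoc (c i), mul_inv_cancel₀ hp', mul_one]
  rw [hF, ← hc, ← (one i).2]
  ext β
  have hβ : coeff β (G i) = coeff β (homogeneousComponent β.degree (G i)) := by
    simp [coeff_homogeneousComponent]
  rw [coeff_add, coeff_homogeneousComponent, coeff_homogeneousComponent]
  by_cases h1 : β.degree = 1
  · rw [if_pos h1, if_neg (by omega), add_zero]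
  · by_cases h2 : β.degree = p + 1
    · rw [if_neg h1, if_pos h2, zero_add]
    · rw [if_neg h1, if_neg h2, add_zero, hβ]
      by_cases h3 : β.degree = 0
      · rw [h3, zero, coeff_zero]
      · rw [mid _ (by omega) h2, coeff_zero]

lemma bracket_of {n p : ℕ} (c : Fin n → ℝ) (hc : ∀ i, c i.rev = c i) :
    bracket (FHH n p) (fun i => C (c i) * FHH n p i) = 0 := by
  funext i
  simp only [bracket, Pi.zero_apply]
  rw [← Finset.sum_sub_distrib]
  refine Finset.sum_eq_zero fun j _ => ?_
  rw [pderiv_C_mul, pderiv_FHH]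
  by_cases h1 : j = i
  · subst h1; ring
  · by_cases h2 : j = i.rev
    · subst h2; rw [hc]; ring
    · simp [h1, h2]

/-- The index of the pair containing `k`. -/
def idx {n : ℕ} (k : Fin n) : Fin ((n + 1) / 2) :=
  ⟨min k.val (n - 1 - k.val), by omega⟩

lemma sum_vHH {n p : ℕ} (d : Fin ((n + 1) / 2) → ℝ) :
    ∑ i, d i • vHH n p i = fun k => C (d (idx k)) * FHH n p k := by
  funext k
  rw [Finset.sum_apply, Finset.sum_eq_single (idx k)]
  · rw [Pi.smul_apply, vHH, if_pos, smul_eq_C_mul]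
    simp only [idx]
    omega
  · intro i _ hi
    rw [Pi.smul_apply, vHH, if_neg, smul_zero]
    intro h
    apply hi
    ext
    simp only [idx]
    omega
  · simp

lemma FHH_ne {n p : ℕ} (k : Fin n) : FHH n p k ≠ 0 := by
  intro h
  have := congrArg (eval (fun _ => (1:ℝ))) h
  simp [FHH] at this
  have h2 : (0:ℝ) < ((p : ℝ) + 1)⁻¹ := by positivity
  linarith

/-- The space of polynomial vector fields `G` with `[F, G] = 0`, for
`F = F_0 + F_p`, `F_0(x) = (x_n, …, x_1)`, `F_p(x) = (1/(p+1))(x_1^{p+1}, …, x_n^{p+1})`,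
has the family `v⁽ⁱ⁾`, `1 ≤ i ≤ ⌊(n+1)/2⌋`, as a basis: the `v⁽ⁱ⁾` are linearly
independent and `[F,G] = 0` iff `G` lies in their span. -/
theorem centralizers_basis (n p : ℕ) (hp : 1 ≤ p) :
    LinearIndependent ℝ (vHH n p) ∧
    ∀ G : Fin n → MvPolynomial (Fin n) ℝ,
      bracket (FHH n p) G = 0 ↔ G ∈ Submodule.span ℝ (Set.range (vHH n p)) := by
  constructor
  · rw [Fintype.linearIndependent_iff]
    intro d hd i
    rw [sum_vHH] at hd
    have hk : i.val < n := by omega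
    have h1 := congrFun hd ⟨i.val, hk⟩
    have h2 : idx (⟨i.val, hk⟩ : Fin n) = i := by
      ext; simp only [idx]; omega
    rw [h2] at h1
    simpa [FHH_ne] using h1
  · intro G
    rw [Submodule.mem_span_range_iff_exists_fun]
    constructor
    · intro h
      obtain ⟨c, hc, hG⟩ := structure_thm hp G h
      refine ⟨fun i => c ⟨i.val, by omega⟩, ?_⟩
      rw [sum_vHH]
      funext k
      rw [hG]
      congr 2
      rcases le_total k.val (n - 1 - k.val) with hk | hk
      · congr 1; ext; simp only [idx]; omega
      · rw [← hc k]
        congr 1; ext; simp only [idx, Fin.val_rev]; omega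
    · rintro ⟨d, rfl⟩
      rw [sum_vHH]
      apply bracket_of
      intro i
      congr 1; ext; simp only [idx, Fin.val_rev]; omega
end

section
/- Fix A_1, …, A_n > 0 and set H_0 = (1/2) Σ_{j=1}^{n} (p_j² + A_j q_j²). Suppose Σ_{j=1}^{n} k_j √(A_j) ≠ 0 for every tuple (k_1,…,k_n) ∈ ℤⁿ with Σ_j k_j odd. Then every homogeneous polynomial centralizer of H_0 has even degree: if K is a homogeneous polynomial of odd degree in (q,p) with {H_0, K} = 0, then K = 0. -/
open MvPolynomial

/-- The Poisson bracket `{H,K} = ⟨J H_x, K_x⟩ = Σ_j (∂H/∂p_j ∂K/∂q_j − ∂H/∂q_j ∂K/∂p_j)`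
on real polynomials in the canonical variables `(q_1,…,q_n,p_1,…,p_n)`; `q_j` is the
variable `Sum.inl j` and `p_j` is the variable `Sum.inr j`. -/
noncomputable def poissonR {n : ℕ} (H K : MvPolynomial (Fin n ⊕ Fin n) ℝ) :
    MvPolynomial (Fin n ⊕ Fin n) ℝ :=
  ∑ j, (pderiv (Sum.inr j) H * pderiv (Sum.inl j) K
        - pderiv (Sum.inl j) H * pderiv (Sum.inr j) K)

/-- The quadratic Hamiltonian `H_0 = (1/2) Σ_j (p_j² + A_j q_j²)`. -/
noncomputable def H0R {n : ℕ} (A : Fin n → ℝ) : MvPolynomial (Fin n ⊕ Fin n) ℝ :=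
  C (1 / 2 : ℝ) * ∑ j, (X (Sum.inr j) ^ 2 + C (A j) * X (Sum.inl j) ^ 2)

noncomputable def auxD {n : ℕ} (w : Fin n → ℂ) :
    Derivation ℂ (MvPolynomial (Fin n ⊕ Fin n) ℂ) (MvPolynomial (Fin n ⊕ Fin n) ℂ) :=
  mkDerivation ℂ (Sum.elim (fun j => C (w j) * X (Sum.inl j)) (fun j => - (C (w j) * X (Sum.inr j))))

lemma auxD_monomial {n : ℕ} (w : Fin n → ℂ) (m : (Fin n ⊕ Fin n) →₀ ℕ) (a : ℂ) :
    auxD w (monomial m a) =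
      C (∑ j, w j * ((m (Sum.inl j) : ℂ) - m (Sum.inr j))) * monomial m a := by
  have key : ∀ i : Fin n ⊕ Fin n, (monomial (m - Finsupp.single i 1) (m i : ℂ)) * X i
      = C (m i : ℂ) * monomial m (1 : ℂ) := by
    intro i
    have h := X_mul_pderiv_monomial (i := i) (m := m) (r := (1 : ℂ))
    rw [pderiv_monomial, one_mul, mul_comm] at h
    rw [h, nsmul_eq_mul, map_natCast]
  rw [auxD, mkDerivation_monomial, Finsupp.sum_fintype _ _ (by simp), Fintype.sum_sum_type,
    ← Finset.sum_add_distrib, map_sum, Finset.sum_mul, Finset.smul_sum]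
  refine Finset.sum_congr rfl fun j _ => ?_
  have ha : (monomial m a : MvPolynomial (Fin n ⊕ Fin n) ℂ) = C a * monomial m 1 := by
    rw [C_mul_monomial, mul_one]
  rw [ha, smul_eq_C_mul]
  simp only [Sum.elim_inl, Sum.elim_inr, smul_eq_mul, C_mul, C_sub]
  linear_combination C a * C (w j) * key (Sum.inl j) - C a * C (w j) * key (Sum.inr j)

lemma auxD_coeff {n : ℕ} (w : Fin n → ℂ) (m : (Fin n ⊕ Fin n) →₀ ℕ)
    (F : MvPolynomial (Fin n ⊕ Fin n) ℂ) :
    coeff m (auxD w F) = (∑ j, w j * ((m (Sum.inl j) : ℂ) - m (Sum.inr j))) * coeff m F := by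
  induction F using MvPolynomial.induction_on' with
  | monomial u a =>
    rw [auxD_monomial, coeff_C_mul, coeff_monomial]
    split_ifs with h
    · rw [h]
    · simp
  | add p q hp hq => rw [map_add, coeff_add, hp, hq, coeff_add, mul_add]

noncomputable def auxP {n : ℕ} (H : MvPolynomial (Fin n ⊕ Fin n) ℝ) :
    Derivation ℝ (MvPolynomial (Fin n ⊕ Fin n) ℝ) (MvPolynomial (Fin n ⊕ Fin n) ℝ) :=
  ∑ j, (pderiv (Sum.inr j) H • pderiv (Sum.inl j) - pderiv (Sum.inl j) H • pderiv (Sum.inr j))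

lemma auxP_apply {n : ℕ} (H K : MvPolynomial (Fin n ⊕ Fin n) ℝ) : auxP H K = poissonR H K := by
  unfold auxP poissonR
  rw [← Derivation.coeFnAddMonoidHom_apply, map_sum, Finset.sum_apply]
  simp

noncomputable def auxPhi {n : ℕ} (w : Fin n → ℂ) :
    MvPolynomial (Fin n ⊕ Fin n) ℝ →ₐ[ℝ] MvPolynomial (Fin n ⊕ Fin n) ℂ :=
  aeval (Sum.elim (fun j => X (Sum.inl j) + X (Sum.inr j))
    (fun j => C (w j) * (X (Sum.inl j) - X (Sum.inr j))))

noncomputable def auxPsi {n : ℕ} (w : Fin n → ℂ) :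
    MvPolynomial (Fin n ⊕ Fin n) ℂ →ₐ[ℂ] MvPolynomial (Fin n ⊕ Fin n) ℂ :=
  aeval (Sum.elim (fun j => C (1/2) * (X (Sum.inl j) + C (w j)⁻¹ * X (Sum.inr j)))
    (fun j => C (1/2) * (X (Sum.inl j) - C (w j)⁻¹ * X (Sum.inr j))))

lemma auxPsi_Phi {n : ℕ} (w : Fin n → ℂ) (hw : ∀ j, w j ≠ 0)
    (K : MvPolynomial (Fin n ⊕ Fin n) ℝ) :
    auxPsi w (auxPhi w K) = map (algebraMap ℝ ℂ) K := by
  have h2 : (C (1/2) : MvPolynomial (Fin n ⊕ Fin n) ℂ) * 2 = 1 := by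
    rw [show (2 : MvPolynomial (Fin n ⊕ Fin n) ℂ) = C 2 from rfl, ← C_mul]; norm_num
  induction K using MvPolynomial.induction_on with
  | C a =>
    have h : auxPhi w (C a) = C (algebraMap ℝ ℂ a) := by
      rw [← algebraMap_eq, AlgHom.commutes]
      rfl
    rw [h, map_C, algHom_C, algebraMap_eq]
  | add p q hp hq => rw [map_add, map_add, hp, hq, map_add]
  | mul_X p s hp =>
    rw [map_mul, map_mul, hp, map_mul, map_X]
    refine congrArg (fun t => map (algebraMap ℝ ℂ) p * t) ?_
    rcases s with j | j
    · simp only [auxPhi, auxPsi, aeval_X, Sum.elim_inl, Sum.elim_inr, map_add]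
      linear_combination X (Sum.inl j) * h2
    · have hj : (C (w j) : MvPolynomial (Fin n ⊕ Fin n) ℂ) * C (w j)⁻¹ = 1 := by
        rw [← C_mul, mul_inv_cancel₀ (hw j), C_1]
      simp only [auxPhi, auxPsi, aeval_X, Sum.elim_inl, Sum.elim_inr, map_mul, map_sub,
        algHom_C, algebraMap_eq]
      linear_combination X (Sum.inr j) * C (w j) * C (w j)⁻¹ * h2 + X (Sum.inr j) * hj

lemma pderiv_inr_H0R {n : ℕ} (A : Fin n → ℝ) (j : Fin n) :
    pderiv (Sum.inr j) (H0R A) = X (Sum.inr j) := by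
  have h2 : (C (1/2) : MvPolynomial (Fin n ⊕ Fin n) ℝ) * 2 = 1 := by
    rw [show (2 : MvPolynomial (Fin n ⊕ Fin n) ℝ) = C 2 from rfl, ← C_mul]; norm_num
  simp only [H0R, pderiv_C_mul, map_sum, map_add, pderiv_pow, pderiv_X, Pi.single_apply]
  simp [smul_eq_C_mul, -one_div]
  linear_combination X (Sum.inr j) * h2

lemma pderiv_inl_H0R {n : ℕ} (A : Fin n → ℝ) (j : Fin n) :
    pderiv (Sum.inl j) (H0R A) = C (A j) * X (Sum.inl j) := by
  have h2 : (C (1/2) : MvPolynomial (Fin n ⊕ Fin n) ℝ) * 2 = 1 := by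
    rw [show (2 : MvPolynomial (Fin n ⊕ Fin n) ℝ) = C 2 from rfl, ← C_mul]; norm_num
  simp only [H0R, pderiv_C_mul, map_sum, map_add, pderiv_pow, pderiv_X, Pi.single_apply]
  simp [smul_eq_C_mul, -one_div]
  linear_combination C (A j) * X (Sum.inl j) * h2

lemma auxP_X_inl {n : ℕ} (A : Fin n → ℝ) (j : Fin n) :
    auxP (H0R A) (X (Sum.inl j)) = X (Sum.inr j) := by
  rw [auxP_apply]
  simp [poissonR, pderiv_inr_H0R, pderiv_inl_H0R, pderiv_X, Pi.single_apply]

lemma auxP_X_inr {n : ℕ} (A : Fin n → ℝ) (j : Fin n) :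
    auxP (H0R A) (X (Sum.inr j)) = - (C (A j) * X (Sum.inl j)) := by
  rw [auxP_apply]
  simp [poissonR, pderiv_inr_H0R, pderiv_inl_H0R, pderiv_X, Pi.single_apply]

lemma aux_intertwine {n : ℕ} (A : Fin n → ℝ) (w : Fin n → ℂ) (hw : ∀ j, w j * w j = -(A j : ℂ))
    (K : MvPolynomial (Fin n ⊕ Fin n) ℝ) :
    auxD w (auxPhi w K) = auxPhi w (auxP (H0R A) K) := by
  have hC : ∀ a : ℝ, auxPhi w (C a) = C (a : ℂ) := by
    intro a
    rw [← algebraMap_eq, AlgHom.commutes]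
    rfl
  induction K using MvPolynomial.induction_on with
  | C a =>
    rw [hC]
    simp [← algebraMap_eq]
  | add p q hp hq => simp only [map_add, hp, hq]
  | mul_X p s hp =>
    have hX : auxD w (auxPhi w (X s)) = auxPhi w (auxP (H0R A) (X s)) := by
      rcases s with j | j
      · rw [auxP_X_inl]
        simp only [auxPhi, auxD, aeval_X, Sum.elim_inl, Sum.elim_inr, map_add, mkDerivation_X]
        ring
      · have hj : (C (w j) : MvPolynomial (Fin n ⊕ Fin n) ℂ) * C (w j) = - C (A j : ℂ) := by
          rw [← C_mul, hw, C_neg]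
        rw [auxP_X_inr, map_neg, map_mul, hC]
        simp only [auxPhi, auxD, aeval_X, Sum.elim_inl, Sum.elim_inr, map_sub, mkDerivation_X,
          ← smul_eq_C_mul, Derivation.map_smul]
        simp only [smul_eq_C_mul]
        linear_combination (X (Sum.inl j) + X (Sum.inr j)) * hj
    simp only [map_mul, Derivation.leibniz, map_add, smul_eq_mul, hp, hX]

/-- Suppose `A_j > 0` and `Σ_j k_j √(A_j) ≠ 0` for every integer tuple `(k_j)` with
`Σ_j k_j` odd.  Then every homogeneous polynomial centralizer of
`H_0 = (1/2) Σ (p_j² + A_j q_j²)` has even degree: a homogeneous `K` of odd degree with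
`{H_0, K} = 0` must vanish. -/
theorem odd_degree_centralizer_vanishes {n : ℕ} (A : Fin n → ℝ) (hA : ∀ j, 0 < A j)
    (hcond : ∀ k : Fin n → ℤ, Odd (∑ j, k j) → ∑ j, (k j : ℝ) * Real.sqrt (A j) ≠ 0)
    (K : MvPolynomial (Fin n ⊕ Fin n) ℝ) (d : ℕ) (hd : Odd d)
    (hK : K.IsHomogeneous d) (hc : poissonR (H0R A) K = 0) :
    K = 0 := by
  let w : Fin n → ℂ := fun j => Complex.I * (Real.sqrt (A j) : ℂ)
  have hw0 : ∀ j, w j ≠ 0 := fun j => mul_ne_zero Complex.I_ne_zero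
    (Complex.ofReal_ne_zero.2 (Real.sqrt_pos.2 (hA j)).ne')
  have hw : ∀ j, w j * w j = -(A j : ℂ) := by
    intro j
    have h1 : ((Real.sqrt (A j) : ℂ)) * (Real.sqrt (A j) : ℂ) = (A j : ℂ) := by
      rw [← Complex.ofReal_mul, Real.mul_self_sqrt (hA j).le]
    simp only [w]
    linear_combination (Real.sqrt (A j) : ℂ) * (Real.sqrt (A j) : ℂ) * Complex.I_mul_I - h1
  have hD : auxD w (auxPhi w K) = 0 := by
    rw [aux_intertwine A w hw, auxP_apply, hc, map_zero]
  have hhom : (auxPhi w K).IsHomogeneous d := by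
    have := IsHomogeneous.aeval (R := ℝ) (m := d) (n := 1) hK (Sum.elim (fun j : Fin n => (X (Sum.inl j) + X (Sum.inr j) : MvPolynomial (Fin n ⊕ Fin n) ℂ))
        (fun j => C (w j) * (X (Sum.inl j) - X (Sum.inr j)))) (by
      rintro (j | j)
      · exact (isHomogeneous_X _ _).add (isHomogeneous_X _ _)
      · exact ((isHomogeneous_X _ _).sub (isHomogeneous_X _ _)).C_mul _)
    rwa [one_mul] at this
  have hzero : auxPhi w K = 0 := by
    ext m
    rw [coeff_zero]
    by_contra hm
    have hdeg := hhom hm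
    have hco := auxD_coeff w m (auxPhi w K)
    rw [hD, coeff_zero] at hco
    have hs := (mul_eq_zero.1 hco.symm).resolve_right hm
    refine hcond (fun j => (m (Sum.inl j) : ℤ) - m (Sum.inr j)) ?_ ?_
    · have hdeg' : ∑ j, m (Sum.inl j) + ∑ j, m (Sum.inr j) = d := by
        rw [← hdeg, ← Fintype.sum_sum_type]
        simp [Finsupp.weight_apply, Finsupp.sum_fintype]
      rw [Finset.sum_sub_distrib]
      have h3 : (∑ j, (m (Sum.inl j) : ℤ)) + ∑ j, (m (Sum.inr j) : ℤ) = d := by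
        exact_mod_cast hdeg'
      obtain ⟨r, hr⟩ := hd
      exact ⟨r - ∑ j, (m (Sum.inr j) : ℤ), by rw [hr] at h3; push_cast at h3; linarith⟩
    · have h4 : Complex.I * ((∑ j, (((m (Sum.inl j) : ℤ) - m (Sum.inr j) : ℤ) : ℝ) * Real.sqrt (A j) : ℝ) : ℂ) = 0 := by
        rw [← hs]
        push_cast
        rw [Finset.mul_sum]
        refine Finset.sum_congr rfl fun j _ => ?_
        simp only [w]
        ring
      exact Complex.ofReal_eq_zero.1 ((mul_eq_zero.1 h4).resolve_left Complex.I_ne_zero)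
  have := auxPsi_Phi w hw0 K
  rw [hzero, map_zero] at this
  exact (map_injective _ (algebraMap ℝ ℂ).injective) (by rw [← this, map_zero])
end
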